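/- Let H be a non-ordinary numerical set (so H ≠ ℕ and T(H) ≠ ℕ). Then t(T(H)) + t(H) ≤ g(A(H)) − g(H) + m(H), and equality holds if and only if T(T(H)) is a numerical semigroup. -/

import Mathlib

open scoped Classical

/-- A numerical set: a subset of ℕ containing 0 with finite complement. -/
def NumericalSet (H : Set ℕ) : Prop := 0 ∈ H ∧ Hᶜ.Finite

/-- A numerical semigroup: a numerical set closed under addition. -/
def NumericalSemigroup (S : Set ℕ) : Prop :=
  NumericalSet S ∧ ∀ a ∈ S, ∀ b ∈ S, a + b ∈ S

/-- Frobenius number: the largest gap. -/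
noncomputable def frob (H : Set ℕ) : ℕ := sSup Hᶜ

/-- Genus: the number of gaps. -/
noncomputable def genus (H : Set ℕ) : ℕ := Hᶜ.ncard

/-- Multiplicity: the smallest nonzero element. -/
noncomputable def mult (H : Set ℕ) : ℕ := sInf {x | x ∈ H ∧ x ≠ 0}

/-- The T-set of a numerical set.  (With truncated subtraction, every `x ≥ frob H`
satisfies `frob H - x = 0`, matching the convention that `F(H) - x` computed in ℤ
is nonpositive, hence not a nonzero element of `H`.) -/
def Tset (H : Set ℕ) : Set ℕ := {x | frob H - x ∉ H ∨ frob H - x = 0}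

/-- The associated numerical semigroup of a numerical set. -/
def A (H : Set ℕ) : Set ℕ := {x | ∀ h ∈ H, x + h ∈ H}

/-- `A*`-operation on numerical sets. -/
def Astar (H : Set ℕ) : Set ℕ := {a | ∀ h ∈ H, h ≠ 0 → a + h ∈ H}

/-- Pseudo-Frobenius numbers of a numerical set. -/
def PF (H : Set ℕ) : Set ℕ := {a | a ∉ H ∧ ∀ h ∈ H, h ≠ 0 → a + h ∈ H}

/-- Type of a numerical set. -/
noncomputable def typ (H : Set ℕ) : ℕ := (PF H).ncard

/-- Almost symmetric: `t(S) = 2 g(S) - F(S)`. -/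
def AlmostSymmetric (S : Set ℕ) : Prop :=
  (typ S : ℤ) = 2 * (genus S : ℤ) - (frob S : ℤ)

/-- An ordinary numerical set: `{0} ∪ {x : x > F(H)}`. -/
def Ordinary (H : Set ℕ) : Prop := H = insert 0 {x : ℕ | frob H < x}

/-- Every numerical set contains all integers beyond its Frobenius number. -/
lemma mem_of_frob_lt {H : Set ℕ} (hH : NumericalSet H) {x : ℕ} (hx : frob H < x) : x ∈ H := by
  by_contra h
  exact absurd (le_csSup hH.2.bddAbove (show x ∈ Hᶜ from h)) (not_le.mpr hx)

lemma frob_notMem {H : Set ℕ} (hH : NumericalSet H) (hne : H ≠ Set.univ) : frob H ∉ H :=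
  Nat.sSup_mem (Set.nonempty_compl.mpr hne) hH.2.bddAbove

lemma mult_mem {H : Set ℕ} (hH : NumericalSet H) : mult H ∈ H ∧ mult H ≠ 0 :=
  Nat.sInf_mem (s := {x | x ∈ H ∧ x ≠ 0})
    ⟨frob H + 1, mem_of_frob_lt hH (Nat.lt_succ_self _), Nat.succ_ne_zero _⟩

lemma mult_le {H : Set ℕ} {x : ℕ} (hx : x ∈ H) (h0 : x ≠ 0) : mult H ≤ x :=
  Nat.sInf_le (show x ∈ {x | x ∈ H ∧ x ≠ 0} from ⟨hx, h0⟩)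

lemma ne_univ_of_not_ordinary {H : Set ℕ} (hord : ¬ Ordinary H) : H ≠ Set.univ := by
  rintro rfl
  apply hord
  ext x
  simp [frob, Nat.eq_zero_or_pos]

lemma mult_lt_frob {H : Set ℕ} (hH : NumericalSet H) (hord : ¬ Ordinary H) :
    mult H < frob H := by
  by_contra hlt
  have hF := frob_notMem hH (ne_univ_of_not_ordinary hord)
  have hm := mult_mem hH
  have hmF : mult H ≠ frob H := fun h => hF (h ▸ hm.1)
  apply hord
  ext x
  simp only [Set.mem_insert_iff, Set.mem_ofPred_eq]
  constructor
  · intro hx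
    by_cases h0 : x = 0
    · exact Or.inl h0
    · have := mult_le hx h0
      omega
  · rintro (rfl | hx)
    · exact hH.1
    · exact mem_of_frob_lt hH hx

lemma notMem_Tset {H : Set ℕ} {x : ℕ} : x ∉ Tset H ↔ frob H - x ∈ H ∧ frob H - x ≠ 0 := by
  simp [Tset]

lemma frob_Tset {H : Set ℕ} (hH : NumericalSet H) (hord : ¬ Ordinary H) :
    frob (Tset H) = frob H - mult H := by
  have hlt := mult_lt_frob hH hord
  have hm := mult_mem hH
  apply IsGreatest.csSup_eq
  constructor
  · rw [Set.mem_compl_iff, notMem_Tset, Nat.sub_sub_self hlt.le]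
    exact hm
  · intro x hx
    rw [Set.mem_compl_iff, notMem_Tset] at hx
    have := mult_le hx.1 hx.2
    omega

/-- The double `T`-set is the translate of `H ∪ {F(H)}` by `-m(H)`. -/
lemma mem_Tset_Tset {H : Set ℕ} (hH : NumericalSet H) (hord : ¬ Ordinary H) {x : ℕ} :
    x ∈ Tset (Tset H) ↔ x + mult H ∈ H ∨ x + mult H = frob H := by
  have hlt := mult_lt_frob hH hord
  have hm := mult_mem hH
  have hx : x ∈ Tset (Tset H) ↔
      frob H - mult H - x ∉ Tset H ∨ frob H - mult H - x = 0 := by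
    rw [← frob_Tset hH hord]
    rfl
  rw [hx, notMem_Tset]
  rcases lt_trichotomy (x + mult H) (frob H) with h | h | h
  · have e : frob H - (frob H - mult H - x) = x + mult H := by omega
    rw [e]
    have h1 : frob H - mult H - x ≠ 0 := by omega
    simp [h1, h.ne, hm.2]
  · exact iff_of_true (Or.inr (by omega)) (Or.inr h)
  · exact iff_of_true (Or.inr (by omega)) (Or.inl (mem_of_frob_lt hH h))

/-- The integers that translate every nonzero element of `H` into `H ∪ {F(H)}`. -/
def frobAstar (H : Set ℕ) : Set ℕ := {b | ∀ h ∈ H, h ≠ 0 → b + h ∈ H ∨ b + h = frob H}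

lemma mem_PF_Tset {H : Set ℕ} (hH : NumericalSet H) (hord : ¬ Ordinary H) {a : ℕ} :
    a ∈ PF (Tset H) ↔ a ∈ frobAstar H ∧ a ∉ Astar H := by
  have hF := frob_notMem hH (ne_univ_of_not_ordinary hord)
  constructor
  · rintro ⟨ha, hadd⟩
    rw [notMem_Tset] at ha
    refine ⟨fun h hh h0 => ?_, fun hA => hF ?_⟩
    · by_contra! hcon
      have hle : a + h < frob H := by
        by_contra hge
        exact hcon.1 (mem_of_frob_lt hH (by omega))
      have ht : frob H - (a + h) ∈ Tset H := by
        left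
        rw [Nat.sub_sub_self hle.le]
        exact hcon.1
      refine notMem_Tset.mpr ?_ (hadd _ ht (by omega))
      rw [show frob H - (a + (frob H - (a + h))) = h by omega]
      exact ⟨hh, h0⟩
    · have := hA _ ha.1 ha.2
      rwa [show a + (frob H - a) = frob H by omega] at this
  · rintro ⟨hB, hA⟩
    simp only [Astar, Set.mem_ofPred_eq, not_forall] at hA
    obtain ⟨k, hk, k0, hak⟩ := hA
    have hakF := (hB k hk k0).resolve_left hak
    refine ⟨?_, fun t ht t0 => ?_⟩
    · rw [notMem_Tset, show frob H - a = k by omega]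
      exact ⟨hk, k0⟩
    · by_contra hcon
      rw [notMem_Tset] at hcon
      refine notMem_Tset.mpr ?_ ht
      have e : a + (frob H - (a + t)) = frob H - t := by omega
      rcases hB _ hcon.1 hcon.2 with h | h
      · rw [e] at h
        exact ⟨h, by omega⟩
      · omega

lemma A_subset_frobAstar {H : Set ℕ} : A H ⊆ frobAstar H := fun _ hx h hh _ => Or.inl (hx h hh)

lemma finite_compl_A {H : Set ℕ} (hH : NumericalSet H) : (A H)ᶜ.Finite := by
  refine (Set.finite_Iic (frob H)).subset fun x hx => ?_
  by_contra hlt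
  rw [Set.mem_Iic, not_le] at hlt
  exact hx fun h _ => mem_of_frob_lt hH (by omega)

lemma genus_A {H : Set ℕ} (hH : NumericalSet H) (hord : ¬ Ordinary H) :
    genus (A H) = genus (frobAstar H) + typ H + typ (Tset H) := by
  have hcompl : (A H)ᶜ = (frobAstar H)ᶜ ∪ PF H ∪ PF (Tset H) := by
    ext x
    have hmA : x ∈ A H ↔ x ∈ Astar H ∧ x ∈ H := by
      constructor
      · exact fun hx => ⟨fun h hh _ => hx h hh, by simpa using hx 0 hH.1⟩
      · rintro ⟨hx, hxH⟩ h hh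
        by_cases h0 : h = 0
        · simpa [h0] using hxH
        · exact hx h hh h0
    have hmP : x ∈ PF H ↔ x ∉ H ∧ x ∈ Astar H := Iff.rfl
    have hmB : x ∈ Astar H → x ∈ frobAstar H := fun hx h hh h0 => Or.inl (hx h hh h0)
    simp only [Set.mem_union, Set.mem_compl_iff, hmA, hmP, mem_PF_Tset hH hord]
    grind
  have hfin := finite_compl_A hH
  rw [hcompl] at hfin
  have hd1 : Disjoint (frobAstar H)ᶜ (PF H) :=
    Set.disjoint_left.mpr fun x hx hP => hx fun h hh h0 => Or.inl (hP.2 h hh h0)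
  have hd2 : Disjoint ((frobAstar H)ᶜ ∪ PF H) (PF (Tset H)) := by
    refine Set.disjoint_left.mpr fun x hx hP => ?_
    rw [mem_PF_Tset hH hord] at hP
    rcases hx with hx | hx
    · exact hx hP.1
    · exact hP.2 hx.2
  have hfin1 := hfin.subset Set.subset_union_left
  rw [genus, hcompl, Set.ncard_union_eq hd2 hfin1 (hfin.subset Set.subset_union_right),
    Set.ncard_union_eq hd1 (hfin1.subset Set.subset_union_left)
      (hfin1.subset Set.subset_union_right)]
  rfl

lemma genus_eq_genus_Tset_Tset_add {H : Set ℕ} (hH : NumericalSet H) (hord : ¬ Ordinary H) :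
    genus H = genus (Tset (Tset H)) + mult H := by
  have hF := frob_notMem hH (ne_univ_of_not_ordinary hord)
  have hlt := mult_lt_frob hH hord
  have hm := mult_mem hH
  have hcompl : Hᶜ = insert (frob H)
      ((· + mult H) '' (Tset (Tset H))ᶜ ∪ (Finset.Ioo 0 (mult H) : Set ℕ)) := by
    ext x
    simp only [Set.mem_insert_iff, Set.mem_union, Set.mem_image, Set.mem_compl_iff,
      mem_Tset_Tset hH hord, Finset.coe_Ioo, Set.mem_Ioo]
    constructor
    · intro hx
      have h0 : x ≠ 0 := fun h => hx (h ▸ hH.1)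
      by_cases hxF : x = frob H
      · exact Or.inl hxF
      by_cases hxm : x < mult H
      · exact Or.inr (Or.inr ⟨by omega, hxm⟩)
      · have e : x - mult H + mult H = x := by omega
        exact Or.inr (Or.inl ⟨x - mult H, by rw [e]; tauto, e⟩)
    · rintro (rfl | ⟨y, hy, rfl⟩ | ⟨h0, hx⟩)
      · exact hF
      · tauto
      · intro hxH
        have := mult_le hxH (by omega)
        omega
  have hfin := hH.2
  rw [hcompl] at hfin
  have hfin1 := hfin.subset (Set.subset_insert _ _)
  have hnot : frob H ∉ (· + mult H) '' (Tset (Tset H))ᶜ ∪ (Finset.Ioo 0 (mult H) : Set ℕ) := by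
    rintro (⟨y, hy, h⟩ | h)
    · exact hy ((mem_Tset_Tset hH hord).mpr (Or.inr h))
    · simp only [Finset.coe_Ioo, Set.mem_Ioo] at h
      omega
  have hdisj : Disjoint ((· + mult H) '' (Tset (Tset H))ᶜ)
      (Finset.Ioo 0 (mult H) : Set ℕ) := by
    refine Set.disjoint_left.mpr ?_
    rintro _ ⟨y, -, rfl⟩ h
    simp at h
  rw [genus, hcompl, Set.ncard_insert_of_notMem hnot hfin1,
    Set.ncard_union_eq hdisj (hfin1.subset Set.subset_union_left)
      (hfin1.subset Set.subset_union_right),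
    Set.ncard_image_of_injective _ (add_left_injective (mult H)), Set.ncard_coe_finset,
    Nat.card_Ioo, genus]
  have := hm.2
  omega

lemma frobAstar_subset_Tset_Tset {H : Set ℕ} (hH : NumericalSet H) (hord : ¬ Ordinary H) :
    frobAstar H ⊆ Tset (Tset H) := fun _ hx =>
  (mem_Tset_Tset hH hord).mpr (hx _ (mult_mem hH).1 (mult_mem hH).2)

lemma numericalSet_Tset_Tset {H : Set ℕ} (hH : NumericalSet H) (hord : ¬ Ordinary H) :
    NumericalSet (Tset (Tset H)) := by
  refine ⟨(mem_Tset_Tset hH hord).mpr (Or.inl (by simpa using (mult_mem hH).1)), ?_⟩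
  exact (finite_compl_A hH).subset (Set.compl_subset_compl.mpr
    (A_subset_frobAstar.trans (frobAstar_subset_Tset_Tset hH hord)))

lemma numericalSemigroup_Tset_Tset_iff {H : Set ℕ} (hH : NumericalSet H)
    (hord : ¬ Ordinary H) :
    NumericalSemigroup (Tset (Tset H)) ↔ Tset (Tset H) ⊆ frobAstar H := by
  have hlt := mult_lt_frob hH hord
  constructor
  · rintro ⟨-, hadd⟩ x hx h hh h0
    have hle := mult_le hh h0
    have e : h - mult H + mult H = h := by omega
    have := hadd x hx (h - mult H) ((mem_Tset_Tset hH hord).mpr (Or.inl (by rwa [e])))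
    rwa [mem_Tset_Tset hH hord, add_assoc, e] at this
  · intro hsub
    refine ⟨numericalSet_Tset_Tset hH hord, fun a ha b hb => ?_⟩
    have hadd : ∀ a ∈ Tset (Tset H), ∀ b, b + mult H ∈ H → a + b ∈ Tset (Tset H) := by
      intro a ha b hb
      have := hsub ha _ hb (by have := (mult_mem hH).2; omega)
      rwa [← add_assoc, ← mem_Tset_Tset hH hord] at this
    rcases (mem_Tset_Tset hH hord).mp hb with h | h
    · exact hadd a ha b h
    · rcases (mem_Tset_Tset hH hord).mp ha with h' | h'
      · rw [add_comm]
        exact hadd b hb a h'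
      · exact (mem_Tset_Tset hH hord).mpr (Or.inl (mem_of_frob_lt hH (by omega)))

theorem stmt_10 (H : Set ℕ) (hH : NumericalSet H) (hord : ¬ Ordinary H) :
    (typ (Tset H) : ℤ) + (typ H : ℤ) ≤
      (genus (A H) : ℤ) - (genus H : ℤ) + (mult H : ℤ) ∧
    ((typ (Tset H) : ℤ) + (typ H : ℤ) =
        (genus (A H) : ℤ) - (genus H : ℤ) + (mult H : ℤ) ↔
      NumericalSemigroup (Tset (Tset H))) := by
  
  have hA := genus_A hH hord
  have hT := genus_eq_genus_Tset_Tset_add hH hord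
  have hsub := Set.compl_subset_compl.mpr (frobAstar_subset_Tset_Tset hH hord)
  have hfin : (frobAstar H)ᶜ.Finite :=
    (finite_compl_A hH).subset (Set.compl_subset_compl.mpr A_subset_frobAstar)
  have hle : genus (Tset (Tset H)) ≤ genus (frobAstar H) := Set.ncard_le_ncard hsub hfin
  refine ⟨by omega, ?_⟩
  rw [numericalSemigroup_Tset_Tset_iff hH hord]
  constructor
  · intro heq
    have hge : (frobAstar H)ᶜ.ncard ≤ (Tset (Tset H))ᶜ.ncard := by
      change genus _ ≤ genus _
      omega
    exact Set.compl_subset_compl.mp (Set.eq_of_subset_of_ncard_le hsub hge hfin).ge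
  · intro h
    have hge : genus (frobAstar H) ≤ genus (Tset (Tset H)) :=
      Set.ncard_le_ncard (Set.compl_subset_compl.mpr h) (numericalSet_Tset_Tset hH hord).2
    omega
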